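/- arXiv:2207.04120 — 8 statements merged into one kernel-verified Lean document; each statement's English description precedes it below -/
import Mathlib

section
/- Let K be a field of characteristic zero and let M = (m_{i,j}) be a frieze matrix of size n over K. Then the Ptolemy relation m_{i,k} m_{j,l} = m_{i,j} m_{k,l} + m_{i,l} m_{j,k} holds for all indices 1 ≤ i ≤ j ≤ k ≤ l ≤ n. -/
/-- A frieze matrix of size `n` over a field `K`, represented as a function on
1-based indices `1,…,n`: it is symmetric on those indices, an entry vanishes
iff it is on the diagonal, and the generalized diamond rule holds. -/
def IsFriezeMatrix {K : Type*} [Field K] (n : ℕ) (m : ℕ → ℕ → K) : Prop :=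
  (∀ i j, 1 ≤ i → i ≤ n → 1 ≤ j → j ≤ n → m i j = m j i) ∧
  (∀ i j, 1 ≤ i → i ≤ n → 1 ≤ j → j ≤ n → (m i j = 0 ↔ i = j)) ∧
  (∀ i j, 1 ≤ i → i + 1 ≤ j → j + 1 ≤ n →
    m i j * m (i + 1) (j + 1) - m (i + 1) j * m i (j + 1) = m i (i + 1) * m j (j + 1))

namespace IsFriezeMatrix

variable {K : Type*} [Field K] {n : ℕ} {m : ℕ → ℕ → K}

lemma diag_eq_zero (hM : IsFriezeMatrix n m) {i : ℕ} (hi : 1 ≤ i) (hin : i ≤ n) : m i i = 0 :=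
  (hM.2.1 i i hi hin hi hin).2 rfl

lemma ne_zero_of_lt (hM : IsFriezeMatrix n m) {i j : ℕ} (hi : 1 ≤ i) (hij : i < j)
    (hjn : j ≤ n) : m i j ≠ 0 := fun h =>
  hij.ne ((hM.2.1 i j hi (by omega) (by omega) hjn).1 h)

/-- Above the diagonal, three consecutive columns of a frieze matrix are linearly dependent, with
coefficients that do not depend on the row. -/
lemma three_term_recurrence (hM : IsFriezeMatrix n m) {i t : ℕ} (hi : 1 ≤ i) (hit : i ≤ t)
    (htn : t + 2 ≤ n) :
    m t (t + 1) * m i (t + 2) + m (t + 1) (t + 2) * m i t = m t (t + 2) * m i (t + 1) := by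
  induction hit using Nat.decreasingInduction with
  | self => rw [hM.diag_eq_zero hi (by omega)]; ring
  | of_succ i hit ih =>
    have ih := ih (by omega)
    have h₁ := hM.2.2 i t hi hit (by omega)
    have h₂ := hM.2.2 i (t + 1) hi (by omega) htn
    refine mul_left_cancel₀ (hM.ne_zero_of_lt (i := i + 1) (j := t + 1)
      (by omega) (by omega) (by omega)) ?_
    linear_combination m (t + 1) (t + 2) * h₁ - m t (t + 1) * h₂ + m i (t + 1) * ih

/-- The Ptolemy relation for two adjacent larger indices. -/
lemma ptolemy_adjacent (hM : IsFriezeMatrix n m) {i j k : ℕ} (hi : 1 ≤ i) (hij : i ≤ j)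
    (hjk : j ≤ k) (hkn : k + 1 ≤ n) :
    m i k * m j (k + 1) = m i j * m k (k + 1) + m i (k + 1) * m j k := by
  induction k, hjk using Nat.le_induction with
  | base => rw [hM.diag_eq_zero (i := j) (by omega) (by omega)]; ring
  | succ k hjk ih =>
    have ih := ih (by omega)
    have h₁ := hM.three_term_recurrence hi (hij.trans hjk) hkn
    have h₂ := hM.three_term_recurrence (hi.trans hij) hjk hkn
    refine mul_left_cancel₀ (hM.ne_zero_of_lt (i := k) (j := k + 1)
      (by omega) (by omega) (by omega)) ?_
    linear_combination m i (k + 1) * h₂ - m j (k + 1) * h₁ + m (k + 1) (k + 2) * ih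

/-- The Ptolemy relation, with the largest index written as `k + d`. -/
lemma ptolemy_add (hM : IsFriezeMatrix n m) {i j k : ℕ} (hi : 1 ≤ i) (hij : i ≤ j)
    (hjk : j ≤ k) (d : ℕ) (hdn : k + d ≤ n) :
    m i k * m j (k + d) = m i j * m k (k + d) + m i (k + d) * m j k := by
  induction d using Nat.twoStepInduction with
  | zero => rw [add_zero, hM.diag_eq_zero (i := k) (by omega) (by omega)]; ring
  | one => exact hM.ptolemy_adjacent hi hij hjk hdn
  | more d ih₀ ih₁ =>
    have ih₀ := ih₀ (by omega)
    have ih₁ := ih₁ (by omega)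
    have h₁ := hM.three_term_recurrence (i := i) (t := k + d) hi (by omega) hdn
    have h₂ := hM.three_term_recurrence (i := j) (t := k + d) (by omega) (by omega) hdn
    have h₃ := hM.three_term_recurrence (i := k) (t := k + d) (by omega) (by omega) hdn
    simp only [← add_assoc] at *
    refine mul_left_cancel₀ (hM.ne_zero_of_lt (i := k + d) (j := k + d + 1)
      (by omega) (by omega) (by omega)) ?_
    linear_combination m i k * h₂ - m i j * h₃ - m j k * h₁ + m (k + d) (k + d + 2) * ih₁
      - m (k + d + 1) (k + d + 2) * ih₀

end IsFriezeMatrix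

/-- Lemma 2 (Ptolemy relation): the entries of a frieze matrix satisfy
`m i k * m j l = m i j * m k l + m i l * m j k` for all `1 ≤ i ≤ j ≤ k ≤ l ≤ n`. -/
theorem ptolemy_of_friezeMatrix {K : Type*} [Field K] [CharZero K]
    (n : ℕ) (m : ℕ → ℕ → K) (hM : IsFriezeMatrix n m) :
    ∀ i j k l : ℕ, 1 ≤ i → i ≤ j → j ≤ k → k ≤ l → l ≤ n →
      m i k * m j l = m i j * m k l + m i l * m j k := by
  intro i j k l hi hij hjk hkl hln
  obtain ⟨d, rfl⟩ := Nat.exists_eq_add_of_le hkl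
  exact hM.ptolemy_add hi hij hjk d hln
end

section
/- Let K be a field of characteristic zero and let M be a frieze matrix of size n ≥ 2 over K. Then det(T_M) = −det(M). -/
/-- The triangulated form `T_M` of a frieze matrix `M = (m i j)`, on 1-based indices. -/
def friezeT {K : Type*} [Field K] (m : ℕ → ℕ → K) (i j : ℕ) : K :=
  if i = 1 then m 2 j
  else if i = 2 then m 1 j
  else if j < i then 0
  else (-2 * m 1 j / m 1 (i - 1)) * m (i - 1) i

namespace IsFriezeMatrix

variable {K : Type*} [Field K] {n : ℕ} {m : ℕ → ℕ → K}

/-- The three-term relation of a frieze matrix for the indices `1 ≤ j ≤ a < a + 1`, given the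
relations for the indices `1 ≤ j < j + 1 ≤ a`. -/
theorem mul_succ_right_of_mul_succ_left (hM : IsFriezeMatrix n m) {a : ℕ} (han : a + 1 ≤ n)
    (hS : ∀ j, 1 ≤ j → j < a →
      m 1 j * m (j + 1) a = m 1 (j + 1) * m j a - m j (j + 1) * m 1 a)
    {j : ℕ} (hj : 1 ≤ j) (hja : j ≤ a) :
    m 1 a * m j (a + 1) = m 1 (a + 1) * m j a + m a (a + 1) * m 1 j := by
  obtain ⟨-, hz, hd⟩ := hM
  induction j, hj using Nat.le_induction with
  | base =>
    have h := (hz 1 1 le_rfl (by omega) le_rfl (by omega)).2 rfl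
    rw [h]
    ring
  | succ j hj ih =>
    have h0 : m j a ≠ 0 := fun h => by
      have := (hz j a hj (by omega) (by omega) (by omega)).1 h
      omega
    refine mul_left_cancel₀ h0 ?_
    linear_combination m 1 a * hd j a hj hja han + m (j + 1) a * ih (by omega) +
      m a (a + 1) * hS j hj hja

/-- The three-term relation of a frieze matrix for the indices `1 ≤ a < a + 1 ≤ j`. -/
theorem mul_succ_left (hM : IsFriezeMatrix n m) {a j : ℕ} (ha : 1 ≤ a) (haj : a < j) (hjn : j ≤ n) :
    m 1 a * m (a + 1) j = m 1 (a + 1) * m a j - m a (a + 1) * m 1 j := by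
  have hz := hM.2.1
  have hd := hM.2.2
  induction j generalizing a with
  | zero => omega
  | succ j ih =>
    rcases Nat.lt_succ_iff_lt_or_eq.1 haj with h | rfl
    · have hF := hM.mul_succ_right_of_mul_succ_left hjn
        (fun a ha haj => ih ha haj (by omega)) ha h.le
      have h0 : m a j ≠ 0 := fun h => by
        have := (hz a j ha (by omega) (by omega) (by omega)).1 h
        omega
      refine mul_left_cancel₀ h0 ?_
      linear_combination m 1 a * hd a j ha h hjn + m a (j + 1) * ih ha h (by omega) -
        m a (a + 1) * hF
    · rw [(hz (a + 1) (a + 1) (by omega) hjn (by omega) hjn).2 rfl]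
      ring

/-- The three-term relation of a frieze matrix for the indices `1 ≤ j ≤ a < a + 1`. -/
theorem mul_succ_right (hM : IsFriezeMatrix n m) {a j : ℕ} (hj : 1 ≤ j) (hja : j ≤ a)
    (han : a + 1 ≤ n) :
    m 1 a * m j (a + 1) = m 1 (a + 1) * m j a + m a (a + 1) * m 1 j :=
  hM.mul_succ_right_of_mul_succ_left han
    (fun _ hj hja => hM.mul_succ_left hj hja (by omega)) hj hja

/-- Every row of `friezeT m` after the second one is obtained from the corresponding row of `m` by
subtracting multiples of the preceding row and of the first row. -/
theorem friezeT_succ (hM : IsFriezeMatrix n m) {a j : ℕ} (ha : 2 ≤ a) (han : a + 1 ≤ n)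
    (hj : 1 ≤ j) (hjn : j ≤ n) :
    friezeT m (a + 1) j =
      m (a + 1) j - m 1 (a + 1) / m 1 a * m a j - m a (a + 1) / m 1 a * m 1 j := by
  have h0 : m 1 a ≠ 0 := fun h => by
    have := (hM.2.1 1 a le_rfl (by omega) (by omega) (by omega)).1 h
    omega
  simp only [friezeT, show a + 1 ≠ 1 by omega, show a + 1 ≠ 2 by omega, if_false,
    Nat.add_sub_cancel]
  split_ifs with h
  · rw [hM.1 (a + 1) j (by omega) han hj hjn, hM.1 a j (by omega) (by omega) hj hjn]
    field_simp
    linear_combination -hM.mul_succ_right hj (Nat.lt_succ_iff.1 h) han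
  · field_simp
    linear_combination -hM.mul_succ_left (by omega : 1 ≤ a) (by omega : a < j) hjn

end IsFriezeMatrix

/-- Adding to each row of a matrix a linear combination of the preceding rows does not change the
determinant. -/
theorem Matrix.det_eq_of_forall_row_eq_add_sum_lt {R ι : Type*} [CommRing R] [Fintype ι]
    [LinearOrder ι] {A B : Matrix ι ι R} (C : Matrix ι ι R) (hC : ∀ i k, i ≤ k → C i k = 0)
    (h : ∀ i j, B i j = A i j + ∑ k, C i k * A k j) : B.det = A.det := by
  have hB : B = (1 + C) * A := by
    ext i j
    rw [h, add_mul, one_mul, Matrix.add_apply, Matrix.mul_apply]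
  have hdet : (1 + C).det = 1 := by
    rw [Matrix.det_of_isLowerTriangular]
    · simp [hC]
    · intro i k hik
      have hik : i < k := hik
      simp [hC i k hik.le, hik.ne]
  rw [hB, Matrix.det_mul, hdet, one_mul]

/-- Proposition 4, second part: `det (T_M) = - det M` for a frieze matrix `M`
of size `n ≥ 2`. -/
theorem det_triangulated_eq_neg_det {K : Type*} [Field K] [CharZero K]
    (n : ℕ) (hn : 2 ≤ n) (m : ℕ → ℕ → K) (hM : IsFriezeMatrix n m) :
    (Matrix.of (fun i j : Fin n => friezeT m (i.1 + 1) (j.1 + 1))).det =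
      - (Matrix.of (fun i j : Fin n => m (i.1 + 1) (j.1 + 1))).det := by
  let z : Fin n := ⟨0, by omega⟩
  let o : Fin n := ⟨1, by omega⟩
  have hzo : z ≠ o := by simp [z, o]
  let T : Matrix (Fin n) (Fin n) K := Matrix.of fun i j => friezeT m (i.1 + 1) (j.1 + 1)
  let p : Fin n → Fin n := fun i => ⟨i.1 - 1, by omega⟩
  let C : Matrix (Fin n) (Fin n) K := fun i k => if 2 ≤ i.1 then
    (if k = p i then -(m 1 (i.1 + 1) / m 1 i.1) else 0) +
      (if k = z then -(m i.1 (i.1 + 1) / m 1 i.1) else 0)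
    else 0
  have hswap : (T.submatrix (Equiv.swap z o) id).det =
      (Matrix.of (fun i j : Fin n => m (i.1 + 1) (j.1 + 1))).det := by
    refine Matrix.det_eq_of_forall_row_eq_add_sum_lt C (fun i k hik => ?_) fun i j => ?_
    · by_cases hi : 2 ≤ i.1
      · have hik : i.1 ≤ k.1 := hik
        have h1 : k ≠ p i := fun h => by
          have : k.1 = i.1 - 1 := congrArg Fin.val h
          omega
        have h2 : k ≠ z := fun h => by
          have : k.1 = 0 := congrArg Fin.val h
          omega
        simp [C, h1, h2]
      · simp [C, hi]
    · by_cases hi : 2 ≤ i.1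
      · have h1 : i ≠ z := fun h => by
          have : i.1 = 0 := congrArg Fin.val h
          omega
        have h2 : i ≠ o := fun h => by
          have : i.1 = 1 := congrArg Fin.val h
          omega
        have hp : i.1 - 1 + 1 = i.1 := by omega
        simp only [C, hi, if_true, add_mul, Finset.sum_add_distrib, ite_mul,
          zero_mul, Finset.sum_ite_eq', Finset.mem_univ, Matrix.submatrix_apply,
          Equiv.swap_apply_of_ne_of_ne h1 h2, id, T, Matrix.of_apply, p, z, hp, zero_add]
        rw [hM.friezeT_succ hi (by omega) (by omega) (by omega)]
        ring
      · obtain h | h : i = z ∨ i = o := by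
          simp only [z, o, Fin.ext_iff]
          omega
        · simp [C, T, h, z, o, friezeT]
        · simp [C, T, h, z, o, friezeT]
  rw [← hswap, Matrix.det_permute, Equiv.Perm.sign_swap hzo]
  simp [T]
end

section
/- Let k ≥ 2 and let (f_{i,j})_{i ≤ j, i,j ∈ ℤ} be a finite frieze pattern of positive integers of order k, i.e. f_{i,i} = 0 and f_{i,i+1} = 1 for all i, f_{i,j} f_{i+1,j+1} − f_{i+1,j} f_{i,j+1} = 1 for all i < j, f_{i,j} is a positive integer for all i < j ≤ i + k − 1, and f_{i,i+k−1} = 1 for all i. Let M_F = (m_{i,j}) ∈ ℤ^{k×k} be the symmetric matrix with m_{i,j} = f_{i,j} for 1 ≤ i ≤ j ≤ k and m_{i,j} = m_{j,i} for 1 ≤ j < i ≤ k. Then det(M_F) = −(−2)^{k−2}. -/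
/-- The three-term recursion satisfied by the rows of a frieze pattern; `n` is the distance of the
entry `f i j` from the row of ones. -/
theorem friezePattern_recursion {k : ℕ} {f : ℤ → ℤ → ℤ}
    (hdiag : ∀ i : ℤ, f i i = 0)
    (hone : ∀ i : ℤ, f i (i + 1) = 1)
    (hdiamond : ∀ i j : ℤ, i < j →
      f i j * f (i + 1) (j + 1) - f (i + 1) j * f i (j + 1) = 1)
    (hpos : ∀ i j : ℤ, i < j → j ≤ i + (k : ℤ) - 1 → 0 < f i j)
    (j : ℤ) (n : ℕ) (hn : n + 2 ≤ k) :
    f (j - n) (j + 2) + f (j - n) j = f j (j + 2) * f (j - n) (j + 1) := by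
  induction n with
  | zero => simp [hdiag, hone]
  | succ n ih =>
    have ih := ih (by omega)
    push_cast
    have h₁ := hdiamond (j - (n + 1)) (j + 1) (by omega)
    have h₂ := hdiamond (j - (n + 1)) j (by omega)
    have hne := (hpos (j - n) (j + 1) (by omega) (by omega)).ne'
    have e₁ : j - ((n : ℤ) + 1) + 1 = j - n := by ring
    have e₂ : j + 1 + 1 = j + 2 := by ring
    rw [e₁, e₂] at h₁
    rw [e₁] at h₂
    apply mul_left_cancel₀ hne
    linear_combination f (j - (n + 1)) (j + 1) * ih - h₁ + h₂

/-- The `2 × 2` minors of two rows `a ≤ i` of a frieze pattern on adjacent columns are constant. -/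
theorem friezePattern_adjacent_minor {k : ℕ} {f : ℤ → ℤ → ℤ}
    (hdiag : ∀ i : ℤ, f i i = 0)
    (hone : ∀ i : ℤ, f i (i + 1) = 1)
    (hdiamond : ∀ i j : ℤ, i < j →
      f i j * f (i + 1) (j + 1) - f (i + 1) j * f i (j + 1) = 1)
    (hpos : ∀ i j : ℤ, i < j → j ≤ i + (k : ℤ) - 1 → 0 < f i j)
    {a i j : ℤ} (hai : a ≤ i) (hij : i ≤ j) (hj : j + 1 ≤ a + k - 1) :
    f a j * f i (j + 1) - f a (j + 1) * f i j = f a i := by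
  induction j, hij using Int.leInduction with
  | base => simp [hdiag, hone]
  | succ j hij ih =>
    have ih := ih (by omega)
    have hrec (b : ℤ) (hab : a ≤ b) (hbj : b ≤ j) :
        f b (j + 2) + f b j = f j (j + 2) * f b (j + 1) := by
      have h := friezePattern_recursion hdiag hone hdiamond hpos j (j - b).toNat (by omega)
      rwa [show j - ((j - b).toNat : ℤ) = b by omega] at h
    have h₁ := hrec a le_rfl (hai.trans hij)
    have h₂ := hrec i hai hij
    rw [show j + 1 + 1 = j + 2 by ring]
    linear_combination ih + f a (j + 1) * h₂ - f i (j + 1) * h₁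

/-- The symmetric `n × n` matrix with entries `f (i + 1) (j + 1)` on and above the diagonal. -/
def friezeMatrix (f : ℤ → ℤ → ℤ) (n : ℕ) : Matrix (Fin n) (Fin n) ℤ :=
  Matrix.of fun i j : Fin n =>
    if (i : ℕ) ≤ (j : ℕ) then f ((i : ℤ) + 1) ((j : ℤ) + 1)
    else f ((j : ℤ) + 1) ((i : ℤ) + 1)

/-- If the last row of `A`, up to a factor `c` and multiples of other rows, is supported on the
diagonal, then `det A` is given by the leading principal minor. -/
theorem Matrix.mul_det_eq_of_last_row {R : Type*} [CommRing R] {n : ℕ}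
    (A : Matrix (Fin (n + 1)) (Fin (n + 1)) R) (p q : Fin n) (c b d x : R)
    (h : c • A (Fin.last n) + b • A p.castSucc + d • A q.castSucc = Pi.single (Fin.last n) x) :
    c * A.det = x * (A.submatrix Fin.castSucc Fin.castSucc).det := by
  have hzero (r : Fin n) : (A.updateRow (Fin.last n) (A r.castSucc)).det = 0 :=
    Matrix.det_updateRow_eq_zero (Fin.castSucc_lt_last r).ne
  have hdet : (A.updateRow (Fin.last n) (Pi.single (Fin.last n) x)).det = c * A.det := by
    rw [← h]
    simp [Matrix.det_updateRow_add, Matrix.det_updateRow_smul, hzero]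
  rw [← hdet, Matrix.det_succ_row _ (Fin.last n), Finset.sum_eq_single (Fin.last n)]
  · have hsub : (A.updateRow (Fin.last n) (Pi.single (Fin.last n) x)).submatrix
        Fin.castSucc Fin.castSucc = A.submatrix Fin.castSucc Fin.castSucc := by
      ext i j
      simp
    simp [Fin.succAbove_last, hsub, ← two_mul]
  · intro j _ hj
    simp [hj]
  · simp

theorem det_friezeMatrix {k : ℕ} {f : ℤ → ℤ → ℤ}
    (hdiag : ∀ i : ℤ, f i i = 0)
    (hone : ∀ i : ℤ, f i (i + 1) = 1)
    (hdiamond : ∀ i j : ℤ, i < j →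
      f i j * f (i + 1) (j + 1) - f (i + 1) j * f i (j + 1) = 1)
    (hpos : ∀ i j : ℤ, i < j → j ≤ i + (k : ℤ) - 1 → 0 < f i j)
    (n : ℕ) (hn : n + 2 ≤ k) :
    (friezeMatrix f (n + 2)).det = -(-2) ^ n * f 1 (n + 2) := by
  induction n with
  | zero =>
    have h := hone 1
    norm_num at h
    simp [friezeMatrix, Matrix.det_fin_two, hdiag, h]
  | succ n ih =>
    have ih := ih (by omega)
    have hne := (hpos 1 (n + 2) (by omega) (by omega)).ne'
    have hsub : (friezeMatrix f (n + 3)).submatrix Fin.castSucc Fin.castSucc =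
        friezeMatrix f (n + 2) := by
      ext i j
      simp [friezeMatrix]
    have key := Matrix.mul_det_eq_of_last_row (friezeMatrix f (n + 3)) (Fin.last (n + 1)) 0
      (f 1 (n + 2)) (-f 1 (n + 3)) (-1) (-2 * f 1 (n + 3)) (by
        ext j
        induction j using Fin.lastCases with
        | last =>
          have h := hone (n + 2)
          rw [show (n : ℤ) + 2 + 1 = n + 3 by ring] at h
          simp [friezeMatrix, hdiag, add_assoc, Fin.le_last]
          norm_num [h]
          ring
        | cast j =>
          have hj := j.isLt
          have h := friezePattern_adjacent_minor hdiag hone hdiamond hpos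
            (a := 1) (i := j + 1) (j := n + 2) (by omega) (by omega) (by omega)
          rw [show (n : ℤ) + 2 + 1 = n + 3 by ring] at h
          simp [friezeMatrix, add_assoc]
          split_ifs with hjn
          · simp [hjn, add_assoc] at h ⊢
            norm_num [hdiag] at h ⊢
            linear_combination h
          · linear_combination h)
    rw [hsub, ih] at key
    apply mul_left_cancel₀ hne
    push_cast
    rw [show (n : ℤ) + 1 + 2 = n + 3 by ring]
    linear_combination key

/-- Corollary 6 (Broline–Crowe–Isaacs / Conway–Coxeter): for a finite frieze pattern
of positive integers of order `k`, the symmetric `k × k` matrix built from a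
fundamental region has determinant `-(-2)^(k-2)`. -/
theorem det_friezePattern_matrix (k : ℕ) (hk : 2 ≤ k) (f : ℤ → ℤ → ℤ)
    (hdiag : ∀ i : ℤ, f i i = 0)
    (hone : ∀ i : ℤ, f i (i + 1) = 1)
    (hdiamond : ∀ i j : ℤ, i < j →
      f i j * f (i + 1) (j + 1) - f (i + 1) j * f i (j + 1) = 1)
    (hpos : ∀ i j : ℤ, i < j → j ≤ i + (k : ℤ) - 1 → 0 < f i j)
    (horder : ∀ i : ℤ, f i (i + (k : ℤ) - 1) = 1) :
    (Matrix.of (fun i j : Fin k =>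
        if (i : ℕ) ≤ (j : ℕ) then f ((i : ℤ) + 1) ((j : ℤ) + 1)
        else f ((j : ℤ) + 1) ((i : ℤ) + 1))).det = -(-2 : ℤ) ^ (k - 2) := by
  obtain ⟨n, rfl⟩ := Nat.exists_eq_add_of_le' hk
  have h := det_friezeMatrix hdiag hone hdiamond hpos n le_rfl
  have hlast := horder 1
  rw [show (1 : ℤ) + (n + 2 : ℕ) - 1 = n + 2 by push_cast; ring] at hlast
  rw [hlast, mul_one] at h
  simpa [friezeMatrix] using h
end

section
/- Let K be a field of characteristic zero, let n ≥ 2, and let a_1,…,a_n, b_1,…,b_n ∈ K. For i ≤ j set Δ_{ij} = a_i b_j − a_j b_i, and let A = (A_{ij}) ∈ K^{n×n} be the symmetric matrix with A_{ij} = Δ_{ij} for i ≤ j and A_{ij} = Δ_{ji} for i > j. Then det(A) = −(−2)^{n−2} · Δ_{1n} · ∏_{i=1}^{n−1} Δ_{i,i+1}. -/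
namespace MinorMatrix

variable {R : Type*} [CommRing R]

/-- The minor `a i * b j - a j * b i` of the `2`-row matrix with rows `a` and `b`. -/
def minor (a b : ℕ → R) (i j : ℕ) : R := a i * b j - a j * b i

/-- The symmetric matrix of minors of the first `n` columns, indexed from `0`. -/
def minorMatrix (n : ℕ) (a b : ℕ → R) : Matrix (Fin n) (Fin n) R :=
  Matrix.of fun i j => if (i : ℕ) ≤ (j : ℕ) then minor a b i j else minor a b j i

/-- The increasing enumeration of the natural numbers different from `1`. -/
def skipOne (k : ℕ) : ℕ := if k = 0 then 0 else k + 1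

lemma skipOne_strictMono : StrictMono skipOne := by
  intro i j h
  simp only [skipOne]
  split_ifs <;> omega

lemma val_succAbove_one {n : ℕ} (k : Fin (n + 2)) :
    (((1 : Fin (n + 3)).succAbove k : Fin (n + 3)) : ℕ) = skipOne k := by
  rw [Fin.succAbove, skipOne]
  have h : k.castSucc < 1 ↔ (k : ℕ) = 0 := by
    rw [Fin.lt_def]
    simp
  simp only [h]
  split_ifs <;> simp_all

lemma minorMatrix_submatrix_succAbove_one (n : ℕ) (a b : ℕ → R) :
    (minorMatrix (n + 3) a b).submatrix (Fin.succAbove 1) (Fin.succAbove 1) =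
      minorMatrix (n + 2) (a ∘ skipOne) (b ∘ skipOne) := by
  ext i j
  simp only [minorMatrix, Matrix.submatrix_apply, Matrix.of_apply, val_succAbove_one,
    skipOne_strictMono.le_iff_le, minor, Function.comp]

/-- By the Plücker relation, a combination of the first three rows of the minor matrix is
supported in a single column. -/
lemma minorMatrix_row_combination (n : ℕ) (a b : ℕ → R) :
    (-minor a b 0 2) • minorMatrix (n + 3) a b 1 +
      (minor a b 1 2 • minorMatrix (n + 3) a b 0 + minor a b 0 1 • minorMatrix (n + 3) a b 2) =
      Pi.single 1 (2 * minor a b 0 1 * minor a b 1 2) := by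
  have h0 : ((0 : Fin (n + 3)) : ℕ) = 0 := rfl
  have h1 : ((1 : Fin (n + 3)) : ℕ) = 1 := rfl
  have h2 : ((2 : Fin (n + 3)) : ℕ) = 2 := rfl
  ext j
  simp only [Pi.add_apply, Pi.smul_apply, smul_eq_mul, minorMatrix, Matrix.of_apply, h0, h1, h2,
    Pi.single_apply, Fin.ext_iff]
  obtain ⟨_ | _ | j, hj⟩ := j
  · simp [minor]
    ring
  · simp [minor]
    ring
  · rw [if_pos (by simp), if_pos (by simp), if_pos (by simp), if_neg (by simp)]
    simp only [minor]
    ring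

lemma det_minorMatrix_mul_minor (n : ℕ) (a b : ℕ → R) :
    -minor a b 0 2 * (minorMatrix (n + 3) a b).det =
      2 * minor a b 0 1 * minor a b 1 2 *
        (minorMatrix (n + 2) (a ∘ skipOne) (b ∘ skipOne)).det := by
  set A := minorMatrix (n + 3) a b with hA
  have h01 : (0 : Fin (n + 3)) ≠ 1 := by simp
  have h21 : (2 : Fin (n + 3)) ≠ 1 := by
    rw [Ne, Fin.ext_iff]
    change ¬ (2 = 1)
    omega
  have zero_of_ne : ∀ k : Fin (n + 3), k ≠ 1 → (A.updateRow 1 (A k)).det = 0 := fun k hk =>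
    Matrix.det_zero_of_row_eq hk (by rw [Matrix.updateRow_self, Matrix.updateRow_ne hk])
  have h := congrArg (fun v => (A.updateRow 1 v).det) (minorMatrix_row_combination n a b)
  simp only [← hA, Matrix.det_updateRow_add, Matrix.det_updateRow_smul, zero_of_ne 0 h01,
    zero_of_ne 2 h21, Matrix.updateRow_eq_self, mul_zero, add_zero] at h
  rw [h, Matrix.det_succ_row _ 1, Finset.sum_eq_single 1]
  · rw [Matrix.submatrix_updateRow_succAbove, hA, minorMatrix_submatrix_succAbove_one]
    simp
  · intro j _ hj
    simp [Pi.single_eq_of_ne hj]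
  · simp

lemma det_minorMatrix_of_minor_ne_zero [IsDomain R] (n : ℕ) (a b : ℕ → R)
    (h : ∀ i j, i < j → minor a b i j ≠ 0) :
    (minorMatrix (n + 2) a b).det =
      -(-2) ^ n * minor a b 0 (n + 1) * ∏ i ∈ Finset.range (n + 1), minor a b i (i + 1) := by
  induction n generalizing a b with
  | zero =>
    simp [minorMatrix, Matrix.det_fin_two, minor]
    ring
  | succ n ih =>
    apply mul_left_cancel₀ (neg_ne_zero.mpr (h 0 2 (by norm_num)))
    rw [det_minorMatrix_mul_minor, ih (a ∘ skipOne) (b ∘ skipOne) fun i j hij => h (skipOne i) (skipOne j) (skipOne_strictMono hij),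
      Finset.prod_range_succ', Finset.prod_range_succ', Finset.prod_range_succ']
    simp only [minor, Function.comp, skipOne]
    simp
    ring

lemma det_minorMatrix (n : ℕ) (a b : ℕ → R) :
    (minorMatrix (n + 2) a b).det =
      -(-2) ^ n * minor a b 0 (n + 1) * ∏ i ∈ Finset.range (n + 1), minor a b i (i + 1) := by
  let x : ℕ → MvPolynomial (ℕ ⊕ ℕ) ℤ := fun i => MvPolynomial.X (Sum.inl i)
  let y : ℕ → MvPolynomial (ℕ ⊕ ℕ) ℤ := fun i => MvPolynomial.X (Sum.inr i)
  have hxy : ∀ i j, i < j → minor x y i j ≠ 0 := by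
    intro i j hij h0
    have h := congrArg (MvPolynomial.eval (Sum.elim (fun _ => 1) fun k : ℕ => (k : ℤ))) h0
    simp [minor, x, y] at h
    omega
  let f := MvPolynomial.aeval (R := ℤ) (Sum.elim a b)
  have hf : ∀ i j, f (minor x y i j) = minor a b i j := fun i j => by
    simp [f, minor, x, y]
  have h := congrArg f (det_minorMatrix_of_minor_ne_zero n x y hxy)
  have hM : f.mapMatrix (minorMatrix (n + 2) x y) = minorMatrix (n + 2) a b := by
    ext i j
    simp only [minorMatrix, AlgHom.mapMatrix_apply, Matrix.map_apply, Matrix.of_apply,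
      apply_ite f, hf]
  rw [AlgHom.map_det, hM] at h
  have hf2 : f 2 = 2 := map_ofNat f 2
  simpa [hf, hf2] using h

end MinorMatrix

/-- Corollary 7 (Baur–Marsh): for a `2 × n` matrix with rows `a` and `b` (1-based),
with minors `Δ i j = a i * b j - a j * b i`, the symmetric matrix `A` with
`A i j = Δ i j` for `i ≤ j` and `A i j = Δ j i` for `i > j` has determinant
`-(-2)^(n-2) * Δ 1 n * ∏_{i=1}^{n-1} Δ i (i+1)`. -/
theorem det_minor_matrix {K : Type*} [Field K] [CharZero K]
    (n : ℕ) (hn : 2 ≤ n) (a b : ℕ → K) :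
    (Matrix.of (fun i j : Fin n =>
        if (i : ℕ) ≤ (j : ℕ) then
          a (i.1 + 1) * b (j.1 + 1) - a (j.1 + 1) * b (i.1 + 1)
        else
          a (j.1 + 1) * b (i.1 + 1) - a (i.1 + 1) * b (j.1 + 1))).det =
      -(-2 : K) ^ (n - 2) * (a 1 * b n - a n * b 1) *
        ∏ i ∈ Finset.Icc 1 (n - 1), (a i * b (i + 1) - a (i + 1) * b i) := by
  obtain ⟨m, rfl⟩ := Nat.exists_eq_add_of_le' hn
  have h := MinorMatrix.det_minorMatrix m (fun i => a (i + 1)) (fun i => b (i + 1))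
  simp only [MinorMatrix.minorMatrix, MinorMatrix.minor, zero_add] at h
  rw [h, Finset.range_eq_Ico, Finset.prod_Ico_add'
    (fun i => a i * b (i + 1) - a (i + 1) * b i) 0 (m + 1) 1]
  rfl
end

section
/- Let K be a field of characteristic zero, let M be a frieze matrix of size n over K, and let m_{i,j}^k denote the entries of the auxiliary matrices M_k. Then for every k ≥ 3 and all 1 ≤ i, j ≤ n: m_{i,j}^k = m_{i,j}^2 if i ∈ {1,2,3}, and m_{i,j}^k = m_{i,j}^2 − ∑_{t=3}^{min(i−1,k)} (m_{1,i}/m_{1,t}) m_{t,j}^{t−1} if 4 ≤ i ≤ n. -/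
/-- The entries `m_{i,j}^k` of the auxiliary matrices `M_k` obtained from a frieze
matrix `M = (m i j)` (1-based indices): `friezeAux m k i j = m_{i,j}^k`. -/
def friezeAux {K : Type*} [Field K] (m : ℕ → ℕ → K) : ℕ → ℕ → ℕ → K
  | 0, i, j => if i = 1 then m 2 j else if i = 2 then m 1 j else m i j
  | 1, i, j => if i = 1 then m 2 j else if i = 2 then m 1 j
      else m i j - m 1 i / m 1 2 * m 2 j
  | 2, i, j => if i = 1 then m 2 j else if i = 2 then m 1 j
      else m i j - m 1 i / m 1 2 * m 2 j - m 2 i / m 1 2 * m 1 j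
  | (k + 3), i, j =>
      if i ≤ k + 3 then friezeAux m (k + 2) i j
      else friezeAux m (k + 2) i j - m 1 i / m 1 (k + 3) * friezeAux m (k + 2) (k + 3) j

/-- Unrolling the recursion for `friezeAux` down to `k = 2`; the sum is empty when `i ≤ 3`. -/
theorem friezeAux_add_two_eq_sub_sum {K : Type*} [Field K] (m : ℕ → ℕ → K) (k i j : ℕ) :
    friezeAux m (k + 2) i j = friezeAux m 2 i j -
      ∑ t ∈ Finset.Icc 3 (min (i - 1) (k + 2)), m 1 i / m 1 t * friezeAux m (t - 1) t j := by
  induction k with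
  | zero =>
    rw [Finset.Icc_eq_empty (by omega), Finset.sum_empty, sub_zero]
  | succ k ih =>
    rw [show k + 1 + 2 = k + 3 from rfl, friezeAux.eq_4]
    split_ifs with h
    · rw [ih, show min (i - 1) (k + 2) = min (i - 1) (k + 3) by omega]
    · rw [ih, show min (i - 1) (k + 2) = k + 2 by omega,
        show min (i - 1) (k + 3) = k + 2 + 1 by omega,
        Finset.sum_Icc_succ_top (a := 3) (b := k + 2) (by omega), ← sub_sub]
      rfl

/-- Remark 10: for `k ≥ 3`, the entries of `M_k` satisfy `m_{i,j}^k = m_{i,j}^2`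
if `i ∈ {1,2,3}`, and
`m_{i,j}^k = m_{i,j}^2 - ∑_{t=3}^{min(i-1,k)} (m 1 i / m 1 t) * m_{t,j}^{t-1}`
if `4 ≤ i ≤ n`. -/
theorem friezeAux_sum_formula {K : Type*} [Field K] [CharZero K]
    (n : ℕ) (m : ℕ → ℕ → K) (hM : IsFriezeMatrix n m) :
    ∀ k : ℕ, 3 ≤ k → ∀ i j : ℕ, 1 ≤ i → i ≤ n → 1 ≤ j → j ≤ n →
      ((i = 1 ∨ i = 2 ∨ i = 3) → friezeAux m k i j = friezeAux m 2 i j) ∧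
      (4 ≤ i → friezeAux m k i j = friezeAux m 2 i j -
        ∑ t ∈ Finset.Icc 3 (min (i - 1) k), m 1 i / m 1 t * friezeAux m (t - 1) t j) := by
  intro k hk i j _ _ _ _
  obtain ⟨k, rfl⟩ := Nat.exists_eq_add_of_le' (show 2 ≤ k by omega)
  refine ⟨fun hi => ?_, fun _ => friezeAux_add_two_eq_sub_sum m k i j⟩
  rw [friezeAux_add_two_eq_sub_sum, Finset.Icc_eq_empty (by omega), Finset.sum_empty, sub_zero]
end

section
/- Let K be a field of characteristic zero, let M be a frieze matrix of size n over K, and let m_{i,j}^k denote the entries of the auxiliary matrices M_k. Then for every k ≥ 3 and all indices with 3 ≤ i ≤ n and 1 ≤ j ≤ min(i−1, k), one has m_{i,j}^k = 0. -/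
/-- The diamond rule propagates to the Ptolemy relation with the first two rows. -/
theorem IsFriezeMatrix.ptolemy {K : Type*} [Field K] {n : ℕ} {m : ℕ → ℕ → K}
    (hM : IsFriezeMatrix n m) {i : ℕ} (hi : 2 ≤ i) :
    ∀ {j : ℕ}, i ≤ j → j ≤ n → m 1 2 * m i j = m 1 i * m 2 j - m 1 j * m 2 i := by
  obtain ⟨-, hzero, hdiamond⟩ := hM
  have diag : ∀ i, 1 ≤ i → i ≤ n → m i i = 0 := fun i h h' => (hzero i i h h' h h').2 rfl
  induction i, hi using Nat.le_induction with
  | base =>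
    intro j hj hn
    rw [diag 2 (by omega) (by omega)]
    ring
  | succ i hi ihi =>
    intro j hj
    induction j, hj using Nat.le_induction with
    | base =>
      intro hn
      rw [diag (i + 1) (by omega) hn]
      ring
    | succ j hj ihj =>
      intro hn
      have h12 : m 1 2 ≠ 0 := fun h =>
        absurd ((hzero 1 2 (by omega) (by omega) (by omega) (by omega)).1 h) (by omega)
      have hij : m i j ≠ 0 := fun h =>
        absurd ((hzero i j (by omega) (by omega) (by omega) (by omega)).1 h) (by omega)
      have e1 := hdiamond i j (by omega) (by omega) hn
      have e2 := hdiamond 1 i (by omega) (by omega) (by omega)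
      have e3 := hdiamond 1 j (by omega) (by omega) hn
      have e4 := ihi (j := j) (by omega) (by omega)
      have e5 := ihi (j := j + 1) (by omega) (by omega)
      have e6 := ihj (by omega)
      norm_num at e2 e3
      apply mul_left_cancel₀ (mul_ne_zero h12 hij)
      linear_combination (m 1 2) ^ 2 * e1 + m 1 2 * m i (j + 1) * e6
        + (m 1 (i + 1) * m 2 j - m 1 j * m 2 (i + 1)) * e5
        - (m 1 (i + 1) * m 2 (j + 1) - m 1 (j + 1) * m 2 (i + 1)) * e4
        - m 1 2 * m i (i + 1) * e3 - (m 1 j * m 2 (j + 1) - m 2 j * m 1 (j + 1)) * e2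

/-- Below the diagonal, the rows `i ≥ 3` of `M_2` are `m_{1,i}` times a vector independent
of `i`. -/
theorem IsFriezeMatrix.friezeAux_two {K : Type*} [Field K] {n : ℕ} {m : ℕ → ℕ → K}
    (hM : IsFriezeMatrix n m) {i j : ℕ} (hi : 3 ≤ i) (hin : i ≤ n) (hj : 1 ≤ j) (hji : j ≤ i) :
    friezeAux m 2 i j = m 1 i * (if j = 1 then 0 else -2 * m 2 j / m 1 2) := by
  have h12 : m 1 2 ≠ 0 := fun h =>
    absurd ((hM.2.1 1 2 (by omega) (by omega) (by omega) (by omega)).1 h) (by omega)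
  have hs : m i j = m j i := hM.1 i j (by omega) hin hj (by omega)
  simp only [friezeAux, if_neg (show i ≠ 1 by omega), if_neg (show i ≠ 2 by omega)]
  split_ifs with h
  · subst h
    have h11 : m 1 1 = 0 := (hM.2.1 1 1 (by omega) (by omega) (by omega) (by omega)).2 rfl
    have h21 : m 2 1 = m 1 2 := hM.1 2 1 (by omega) (by omega) (by omega) (by omega)
    rw [hs, h11, h21]
    field_simp
    ring
  · have := hM.ptolemy (i := j) (by omega) hji hin
    rw [hs]
    field_simp
    linear_combination this

theorem friezeAux_succ_of_lt {K : Type*} [Field K] {m : ℕ → ℕ → K} {k i : ℕ}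
    (hk : 2 ≤ k) (hi : k + 1 < i) (j : ℕ) :
    friezeAux m (k + 1) i j =
      friezeAux m k i j - m 1 i / m 1 (k + 1) * friezeAux m k (k + 1) j := by
  obtain ⟨p, rfl⟩ : ∃ p, k = p + 2 := ⟨k - 2, by omega⟩
  exact if_neg (by omega)

/-- The elimination steps telescope: `M_k` arises from `M_2` by subtracting from each row
`i > k` the multiple `m_{1,i} / m_{1,k}` of row `k`. -/
theorem friezeAux_telescope {K : Type*} [Field K] {m : ℕ → ℕ → K} {k : ℕ}
    (hk : 3 ≤ k) (hm : ∀ l, 3 ≤ l → l ≤ k → m 1 l ≠ 0) {i : ℕ} (hi : k < i) (j : ℕ) :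
    friezeAux m k i j = friezeAux m 2 i j - m 1 i / m 1 k * friezeAux m 2 k j := by
  induction k, hk using Nat.le_induction generalizing i with
  | base => exact friezeAux_succ_of_lt le_rfl hi j
  | succ k hk ih =>
    have ih' := @ih fun l h h' => hm l h (by omega)
    have hk0 := hm k hk (by omega)
    have hk1 := hm (k + 1) (by omega) le_rfl
    rw [friezeAux_succ_of_lt (by omega) hi, ih' (by omega), ih' (by omega)]
    field_simp
    ring

/-- For `i > k ≥ 2`, row `i` of `M_k` vanishes in the columns `j ≤ k`. -/
theorem IsFriezeMatrix.friezeAux_eq_zero_of_lt {K : Type*} [Field K] {n : ℕ} {m : ℕ → ℕ → K}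
    (hM : IsFriezeMatrix n m) {k i j : ℕ} (hk : 2 ≤ k) (hki : k < i) (hin : i ≤ n)
    (hj : 1 ≤ j) (hjk : j ≤ k) : friezeAux m k i j = 0 := by
  obtain rfl | hk := hk.eq_or_lt
  · rw [hM.friezeAux_two (by omega) hin hj (by omega)]
    split_ifs with h
    · simp
    · obtain rfl : j = 2 := by omega
      simp [(hM.2.1 2 2 (by omega) (by omega) (by omega) (by omega)).2 rfl]
  · have hne : ∀ l, 3 ≤ l → l ≤ k → m 1 l ≠ 0 := fun l h h' h0 =>
      absurd ((hM.2.1 1 l (by omega) (by omega) (by omega) (by omega)).1 h0) (by omega)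
    have hk0 := hne k hk le_rfl
    rw [friezeAux_telescope hk hne hki, hM.friezeAux_two (by omega) hin hj (by omega),
      hM.friezeAux_two hk (by omega) hj hjk, ← mul_assoc, div_mul_cancel₀ _ hk0, sub_self]

/-- Lemma 11 (ii): for `k ≥ 3`, the entries of `M_k` vanish below the diagonal in
columns `j ≤ min (i-1) k`: if `3 ≤ i ≤ n` and `1 ≤ j ≤ min (i-1) k` then
`m_{i,j}^k = 0`. -/
theorem friezeAux_eq_zero {K : Type*} [Field K] [CharZero K]
    (n : ℕ) (m : ℕ → ℕ → K) (hM : IsFriezeMatrix n m) :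
    ∀ k : ℕ, 3 ≤ k → ∀ i j : ℕ, 3 ≤ i → i ≤ n → 1 ≤ j → j ≤ min (i - 1) k →
      friezeAux m k i j = 0 := by
  intro k hk i j hi hin hj hjk
  have hji : j ≤ i - 1 := hjk.trans (min_le_left _ _)
  obtain hik | hki := le_or_gt i k
  · have stable : ∀ l, i - 1 ≤ l → friezeAux m l i j = friezeAux m (i - 1) i j := by
      intro l hl
      induction l, hl using Nat.le_induction with
      | base => rfl
      | succ l hl ih =>
        obtain ⟨p, rfl⟩ : ∃ p, l = p + 2 := ⟨l - 2, by omega⟩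
        rw [friezeAux, if_pos (by omega), ih]
    rw [stable k (by omega)]
    exact hM.friezeAux_eq_zero_of_lt (by omega) (by omega) hin hj hji
  · exact hM.friezeAux_eq_zero_of_lt (by omega) hki hin hj (hjk.trans (min_le_right _ _))
end

section
/- Let K be a field of characteristic zero, let M be a frieze matrix of size n over K, and let m_{i,j}^k denote the entries of the auxiliary matrices M_k. Then for every k ≥ 3 and all indices with 3 ≤ i ≤ k+1 and i ≤ j ≤ n, one has m_{i,j}^k = (−2 m_{1,j}/m_{1,i−1}) · m_{i−1,i}. -/
namespace IsFriezeMatrix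

variable {K : Type*} [Field K] {n : ℕ} {m : ℕ → ℕ → K}

lemma apply_self (hM : IsFriezeMatrix n m) {i : ℕ} (hi : 1 ≤ i) (hn : i ≤ n) : m i i = 0 :=
  (hM.2.1 i i hi hn hi hn).2 rfl

lemma apply_ne_zero (hM : IsFriezeMatrix n m) {i j : ℕ} (hi : 1 ≤ i) (hij : i < j)
    (hn : j ≤ n) : m i j ≠ 0 :=
  fun h => hij.ne ((hM.2.1 i j hi (by omega) (by omega) hn).1 h)

/-- Each row of a frieze matrix satisfies the same three-term linear recurrence to the right of
the diagonal. -/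
lemma recurrence (hM : IsFriezeMatrix n m) {i j : ℕ} (hi : 1 ≤ i) (hij : i ≤ j)
    (hn : j + 2 ≤ n) :
    m i (j + 1) * m j (j + 2) = m i j * m (j + 1) (j + 2) + m j (j + 1) * m i (j + 2) := by
  induction hij using Nat.decreasingInduction with
  | self => rw [hM.apply_self hi (by omega)]; ring
  | of_succ i hij ih =>
    have h := ih (by omega)
    have h₁ := hM.2.2 i j hi (by omega) (by omega)
    have h₂ := hM.2.2 i (j + 1) hi (by omega) (by omega)
    apply mul_left_cancel₀ (hM.apply_ne_zero (i := i + 1) (j := j + 1) (by omega) (by omega)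
      (by omega))
    linear_combination m i (j + 1) * h - m (j + 1) (j + 2) * h₁ + m j (j + 1) * h₂

/-- A linear relation between rows of a frieze matrix that holds in two consecutive columns
holds in all later columns. -/
lemma linear_relation (hM : IsFriezeMatrix n m) {p q r c : ℕ} (hp : 1 ≤ p) (hpc : p ≤ c)
    (hq : 1 ≤ q) (hqc : q ≤ c) (hr : 1 ≤ r) (hrc : r ≤ c) {x y z : K}
    (h₀ : x * m p c = y * m q c + z * m r c)
    (h₁ : c + 1 ≤ n → x * m p (c + 1) = y * m q (c + 1) + z * m r (c + 1))
    {l : ℕ} (hl : c ≤ l) (hn : l ≤ n) : x * m p l = y * m q l + z * m r l := by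
  suffices H : ∀ d, (c + d ≤ n → x * m p (c + d) = y * m q (c + d) + z * m r (c + d)) ∧
      (c + d + 1 ≤ n →
        x * m p (c + d + 1) = y * m q (c + d + 1) + z * m r (c + d + 1)) by
    obtain ⟨d, rfl⟩ := Nat.exists_eq_add_of_le hl
    exact (H d).1 hn
  intro d
  induction d with
  | zero => exact ⟨fun _ => h₀, h₁⟩
  | succ d ih =>
    refine ⟨ih.2, fun hd => ?_⟩
    have e₀ := ih.1 (by omega)
    have e₁ := ih.2 (by omega)
    have rp := hM.recurrence (i := p) (j := c + d) hp (by omega) (by omega)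
    have rq := hM.recurrence (i := q) (j := c + d) hq (by omega) (by omega)
    have rr := hM.recurrence (i := r) (j := c + d) hr (by omega) (by omega)
    apply mul_left_cancel₀ (hM.apply_ne_zero (i := c + d) (j := c + d + 1) (by omega) (by omega)
      (by omega))
    change _ * (x * m p (c + d + 2)) = _ * (y * m q (c + d + 2) + z * m r (c + d + 2))
    linear_combination m (c + d) (c + d + 2) * e₁ - m (c + d + 1) (c + d + 2) * e₀
      - x * rp + y * rq + z * rr

/-- The Ptolemy relation for `a`, `a + 1`, `c`, `l`. -/
lemma ptolemy_left (hM : IsFriezeMatrix n m) {a c l : ℕ} (ha : 1 ≤ a) (hac : a + 1 ≤ c)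
    (hcl : c ≤ l) (hn : l ≤ n) :
    m a c * m (a + 1) l = m a (a + 1) * m c l + m (a + 1) c * m a l := by
  refine hM.linear_relation (by omega) hac (by omega) le_rfl ha (by omega) ?_ (fun h => ?_) hcl hn
  · rw [hM.apply_self (i := c) (by omega) (by omega)]; ring
  · linear_combination hM.2.2 a c ha hac h

/-- The Ptolemy relation for `a`, `b`, `b + 1`, `l`. -/
lemma ptolemy_middle (hM : IsFriezeMatrix n m) {a b l : ℕ} (ha : 1 ≤ a) (hab : a ≤ b)
    (hbl : b + 1 ≤ l) (hn : l ≤ n) :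
    m a (b + 1) * m b l = m a b * m (b + 1) l + m b (b + 1) * m a l := by
  refine hM.linear_relation (by omega) (by omega) (by omega) le_rfl ha (by omega) ?_
    (fun h => ?_) hbl hn
  · rw [hM.apply_self (i := b + 1) (by omega) (by omega)]; ring
  · exact hM.recurrence ha hab h

end IsFriezeMatrix

/-- The entries of the auxiliary matrices on and above the diagonal, in the rows that have not
yet been reduced to their final form. -/
lemma friezeAux_eq_of_lt {K : Type*} [Field K] {n : ℕ} {m : ℕ → ℕ → K}
    (hM : IsFriezeMatrix n m) {k i j : ℕ} (hk : 2 ≤ k) (hki : k < i) (hij : i ≤ j)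
    (hj : j ≤ n) : friezeAux m k i j = -2 * m 1 j / m 1 k * m k i := by
  induction k, hk using Nat.le_induction generalizing i with
  | base =>
    have h := hM.ptolemy_left (a := 1) (c := i) (l := j) le_rfl (by omega) hij hj
    have h₁ := hM.apply_ne_zero (i := 1) (j := 2) le_rfl (by omega) (by omega)
    rw [friezeAux, if_neg (by omega), if_neg (by omega)]
    field_simp
    linear_combination -h
  | succ k hk ih =>
    obtain ⟨k, rfl⟩ := Nat.exists_eq_add_of_le' hk
    have h := hM.ptolemy_middle (a := 1) (b := k + 2) (l := i) le_rfl (by omega) (by omega)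
      (by omega)
    have h₁ := hM.apply_ne_zero (i := 1) (j := k + 2) le_rfl (by omega) (by omega)
    have h₂ := hM.apply_ne_zero (i := 1) (j := k + 3) le_rfl (by omega) (by omega)
    change friezeAux m (k + 3) i j = -2 * m 1 j / m 1 (k + 3) * m (k + 3) i
    rw [friezeAux, if_neg (by omega), ih (by omega) hij,
      ih (i := k + 3) (by omega) (by omega)]
    field_simp
    linear_combination -2 * m 1 j * h

/-- Row `i` does not change after step `i - 1`. -/
lemma friezeAux_eq_of_le {K : Type*} [Field K] (m : ℕ → ℕ → K) {k l i : ℕ} (hk : 2 ≤ k)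
    (hkl : k ≤ l) (hi : i ≤ k + 1) (j : ℕ) : friezeAux m l i j = friezeAux m k i j := by
  induction l, hkl using Nat.le_induction with
  | base => rfl
  | succ l hl ih =>
    obtain ⟨l, rfl⟩ := Nat.exists_eq_add_of_le' (hk.trans hl)
    change friezeAux m (l + 3) i j = _
    rw [friezeAux, if_pos (by omega), ih]

/-- Lemma 11 (iii): for `k ≥ 3`, if `3 ≤ i ≤ k + 1` and `i ≤ j ≤ n` then
`m_{i,j}^k = (-2 * m 1 j / m 1 (i-1)) * m (i-1) i`. -/
theorem friezeAux_eq_triangulated {K : Type*} [Field K] [CharZero K]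
    (n : ℕ) (m : ℕ → ℕ → K) (hM : IsFriezeMatrix n m) :
    ∀ k : ℕ, 3 ≤ k → ∀ i j : ℕ, 3 ≤ i → i ≤ k + 1 → i ≤ j → j ≤ n →
      friezeAux m k i j = -2 * m 1 j / m 1 (i - 1) * m (i - 1) i := by
  intro k hk i j hi hik hij hj
  rw [friezeAux_eq_of_le m (k := i - 1) (by omega) (by omega) (by omega),
    friezeAux_eq_of_lt hM (by omega) (by omega) hij hj]
end

section
/- Let K be a field of characteristic zero and let M = (m_{i,j}) be a frieze matrix of size n ≥ 2 over K in which every superdiagonal entry equals one (m_{i,i+1} = 1 for 1 ≤ i ≤ n−1) and the corner entry m_{1,n} equals one. Then det(M) = −(−2)^{n−2}. -/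
/-- The recurrence `m i j + m (i + 2) j = m i (i + 2) * m (i + 1) j` to the right of the diagonal. -/
theorem IsFriezeMatrix.recurrence_right {K : Type*} [Field K] {n : ℕ} {m : ℕ → ℕ → K}
    (hM : IsFriezeMatrix n m) (hsuper : ∀ i : ℕ, 1 ≤ i → i ≤ n - 1 → m i (i + 1) = 1)
    {i j : ℕ} (hi : 1 ≤ i) (hij : i + 2 ≤ j) (hj : j ≤ n) :
    m i j + m (i + 2) j = m i (i + 2) * m (i + 1) j := by
  obtain ⟨-, hzero, hdiamond⟩ := hM
  induction j, hij using Nat.le_induction with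
  | base =>
    have h₁ : m (i + 2) (i + 2) = 0 :=
      (hzero _ _ (by omega) (by omega) (by omega) (by omega)).2 rfl
    have h₂ : m (i + 1) (i + 2) = 1 := hsuper (i + 1) (by omega) (by omega)
    rw [h₁, h₂]; ring
  | succ j hij ih =>
    have ih := ih (by omega)
    have h₁ := hdiamond i j (by omega) (by omega) (by omega)
    have h₂ : m (i + 1) j * m (i + 2) (j + 1) - m (i + 2) j * m (i + 1) (j + 1) =
      m (i + 1) (i + 2) * m j (j + 1) := hdiamond (i + 1) j (by omega) (by omega) (by omega)
    have h₃ : m (i + 1) (i + 2) = 1 := hsuper (i + 1) (by omega) (by omega)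
    rw [hsuper i (by omega) (by omega)] at h₁
    rw [h₃] at h₂
    have hne : m (i + 1) j ≠ 0 := fun h => by
      have := (hzero _ _ (by omega) (by omega) (by omega) (by omega)).1 h
      omega
    apply mul_left_cancel₀ hne
    linear_combination m (i + 1) (j + 1) * ih + h₂ - h₁

/-- The recurrence `m j i + m j (i + 2) = m i (i + 2) * m j (i + 1)` to the left of the diagonal. -/
theorem IsFriezeMatrix.recurrence_left {K : Type*} [Field K] {n : ℕ} {m : ℕ → ℕ → K}
    (hM : IsFriezeMatrix n m) (hsuper : ∀ i : ℕ, 1 ≤ i → i ≤ n - 1 → m i (i + 1) = 1)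
    {i j : ℕ} (hj : 1 ≤ j) (hji : j ≤ i) (hi : i + 2 ≤ n) :
    m j i + m j (i + 2) = m i (i + 2) * m j (i + 1) := by
  obtain ⟨-, hzero, hdiamond⟩ := hM
  induction hji using Nat.decreasingInduction with
  | self =>
    rw [(hzero i i (by omega) (by omega) (by omega) (by omega)).2 rfl,
      hsuper i (by omega) (by omega)]
    ring
  | of_succ j hji ih =>
    have ih := ih (by omega)
    have h₁ := hdiamond j i (by omega) (by omega) (by omega)
    have h₂ : m j (i + 1) * m (j + 1) (i + 2) - m (j + 1) (i + 1) * m j (i + 2) =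
      m j (j + 1) * m (i + 1) (i + 2) := hdiamond j (i + 1) (by omega) (by omega) (by omega)
    have h₃ : m (i + 1) (i + 2) = 1 := hsuper (i + 1) (by omega) (by omega)
    rw [hsuper i (by omega) (by omega)] at h₁
    rw [h₃] at h₂
    have hne : m (j + 1) (i + 1) ≠ 0 := fun h => by
      have := (hzero _ _ (by omega) (by omega) (by omega) (by omega)).1 h
      omega
    apply mul_left_cancel₀ hne
    linear_combination m j (i + 1) * ih + h₁ - h₂

/-- The determinant of a matrix whose first column `f` and whose remaining columns, away from the
superdiagonal, satisfy the three-term recurrence with coefficients `c`. -/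
theorem det_of_three_term_recurrence {K : Type*} [CommRing K] (m : ℕ → ℕ → K) (f c : ℕ → K)
    (k s : ℕ) (hdiag : m (s + k + 1) (s + k + 1) = 0)
    (hsuper : ∀ i, s ≤ i → i ≤ s + k → m i (i + 1) = 1)
    (hmid : ∀ i, s ≤ i → i + 1 ≤ s + k →
      m i (i + 1) + m (i + 2) (i + 1) - c i * m (i + 1) (i + 1) = 2)
    (hf : ∀ i, s ≤ i → i + 1 ≤ s + k → f i + f (i + 2) = c i * f (i + 1))
    (hm : ∀ i j, s ≤ i → i + 1 ≤ s + k → i + 2 ≤ j → j ≤ s + k + 1 →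
      m i j + m (i + 2) j = c i * m (i + 1) j) :
    (Matrix.of (fun i j : Fin (k + 2) =>
      if j = 0 then f (s + i) else m (s + i) (s + j))).det = -(-2 : K) ^ k * f (s + k + 1) := by
  induction k generalizing s with
  | zero =>
    have h := hsuper s le_rfl le_rfl
    simp only [Nat.add_zero] at hdiag
    simp [Matrix.det_fin_two, hdiag, h]
  | succ k ih =>
    set A : Matrix (Fin (k + 3)) (Fin (k + 3)) K := Matrix.of (fun i j : Fin (k + 3) =>
      if j = 0 then f (s + i) else m (s + i) (s + j)) with hA
    have hdet : (A.updateRow 0 (fun j => if j = 1 then 2 else 0)).det = A.det := by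
      have hv2 : ((2 : Fin (k + 3)) : ℕ) = 2 := rfl
      have h2 : (2 : Fin (k + 3)) ≠ 0 := by rw [Ne, Fin.ext_iff, hv2]; simp
      have h₁ := Matrix.det_updateRow_add_smul_self A (i := 0) (j := 1) (by simp) (-c s)
      have h₂ := Matrix.det_updateRow_add_smul_self (A.updateRow 0 (A 0 + (-c s) • A 1))
        (i := 0) (j := 2) h2.symm 1
      rw [← h₁, ← h₂, Matrix.updateRow_idem]
      congr 2
      funext j
      rw [Matrix.updateRow_self, Matrix.updateRow_ne h2]
      simp only [Pi.add_apply, Pi.smul_apply, smul_eq_mul, hA, Matrix.of_apply, Fin.val_zero,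
        Fin.val_one, hv2, Nat.add_zero]
      rcases Fin.eq_zero_or_eq_succ j with rfl | ⟨j, rfl⟩
      · have := hf s le_rfl (by omega)
        simp only [Fin.zero_eq_one_iff, if_true]
        rw [if_neg (by omega)]
        linear_combination -this
      · rcases Fin.eq_zero_or_eq_succ j with rfl | ⟨j, rfl⟩
        · have := hmid s le_rfl (by omega)
          simp
          linear_combination -this
        · have := hm s (s + (j.succ.succ : Fin (k + 3))) le_rfl (by omega) (by simp)
            (by have := j.succ.succ.isLt; omega)
          have hj1 : (j.succ.succ : Fin (k + 3)) ≠ 1 := by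
            rw [Ne, Fin.ext_iff, Fin.val_one, Fin.val_succ, Fin.val_succ]; omega
          rw [if_neg hj1, if_neg (Fin.succ_ne_zero _), if_neg (Fin.succ_ne_zero _),
            if_neg (Fin.succ_ne_zero _)]
          linear_combination -this
    rw [← hdet, Matrix.det_succ_row_zero, Finset.sum_eq_single 1]
    · have hsub : ((A.updateRow 0 (fun j => if j = 1 then 2 else 0)).submatrix Fin.succ
          (Fin.succAbove 1)) = Matrix.of (fun i j : Fin (k + 2) =>
          if j = 0 then f (s + 1 + i) else m (s + 1 + i) (s + 1 + j)) := by
        ext i j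
        rw [Matrix.submatrix_apply, Matrix.updateRow_ne (Fin.succ_ne_zero i)]
        rcases Fin.eq_zero_or_eq_succ j with rfl | ⟨j, rfl⟩
        · simp [hA, add_assoc, add_comm 1]
        · have : (1 : Fin (k + 3)).succAbove j.succ = j.succ.succ :=
            Fin.succAbove_of_le_castSucc _ _ (by simp [Fin.le_def])
          simp [hA, this, Fin.succ_ne_zero, add_assoc, add_comm 1]
      have e : s + (k + 1) + 1 = s + 1 + k + 1 := by ring
      rw [hsub, ih (s + 1) (e ▸ hdiag) (fun i _ _ => hsuper i (by omega) (by omega))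
        (fun i _ _ => hmid i (by omega) (by omega)) (fun i _ _ => hf i (by omega) (by omega))
        (fun i j _ _ _ _ => hm i j (by omega) (by omega) (by omega) (by omega)), e]
      simp
      ring
    · intro j _ hj
      simp [hj]
    · simp

/-- If `M` is a frieze matrix of size `n ≥ 2` whose superdiagonal entries
`m i (i+1)` (for `1 ≤ i ≤ n-1`) and whose corner entry `m 1 n` all equal one,
then `det M = -(-2)^(n-2)`. -/
theorem det_friezeMatrix_of_superdiag_one {K : Type*} [Field K] [CharZero K]
    (n : ℕ) (hn : 2 ≤ n) (m : ℕ → ℕ → K) (hM : IsFriezeMatrix n m)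
    (hsuper : ∀ i : ℕ, 1 ≤ i → i ≤ n - 1 → m i (i + 1) = 1)
    (hcorner : m 1 n = 1) :
    (Matrix.of (fun i j : Fin n => m (i.1 + 1) (j.1 + 1))).det =
      -(-2 : K) ^ (n - 2) := by
  obtain ⟨k, rfl⟩ := Nat.exists_eq_add_of_le' hn
  have hsymm := hM.1
  have hdiag : ∀ i, 1 ≤ i → i ≤ k + 2 → m i i = 0 := fun i h₁ h₂ => (hM.2.1 i i h₁ h₂ h₁ h₂).2 rfl
  have h := det_of_three_term_recurrence m (m 1) (fun i => m i (i + 2)) k 1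
    (hdiag _ (by omega) (by omega)) (fun i h₁ h₂ => hsuper i h₁ (by omega))
    (fun i h₁ h₂ => by
      have h₃ : m (i + 1) (i + 2) = 1 := hsuper (i + 1) (by omega) (by omega)
      rw [hsymm (i + 2) (i + 1) (by omega) (by omega) (by omega) (by omega), h₃,
        hsuper i h₁ (by omega), hdiag (i + 1) (by omega) (by omega)]
      ring)
    (fun i h₁ h₂ => hM.recurrence_left hsuper le_rfl h₁ (by omega))
    (fun i j h₁ _ h₂ h₃ => hM.recurrence_right hsuper h₁ h₂ (by omega))
  have e : 1 + k + 1 = k + 2 := by ring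
  rw [e, hcorner, mul_one] at h
  rw [Nat.add_sub_cancel, ← h]
  congr 1
  ext i j
  simp only [Matrix.of_apply, add_comm 1]
  split_ifs with hj
  · subst hj
    exact hsymm _ _ (by omega) (by omega) (by simp) (by simp)
  · rfl
end
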